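/- For 0 < s ≤ 1/2, the pointwise product of two functions in H^s(ℝ²) satisfies the bound ‖ψφ‖_{Ḣ^{2s−1}(ℝ²)} ≲ ‖ψ‖_{H^s(ℝ²)} ‖φ‖_{H^s(ℝ²)}; in particular for A = |∇|^{−1}(ψφ) one has ‖A‖_{Ḣ^{2s}} ≲ ‖ψ‖_{H^s} ‖φ‖_{H^s}. -/

import Mathlib

open MeasureTheory FourierTransform SchwartzMap
open scoped ENNReal NNReal

noncomputable section

/-- The inhomogeneous Sobolev norm ‖f‖_{H^s(ℝ²)} = ‖⟨ξ⟩^s f̂‖_{L²}, on the Fourier side. -/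
def sobNorm (s : ℝ) (f : EuclideanSpace ℝ (Fin 2) → ℂ) : ℝ≥0∞ :=
  (∫⁻ ξ, ENNReal.ofReal ((1 + ‖ξ‖ ^ 2) ^ s * ‖𝓕 f ξ‖ ^ 2)) ^ (1 / 2 : ℝ)

/-- The homogeneous Sobolev norm ‖f‖_{Ḣ^s(ℝ²)} = ‖|ξ|^s f̂‖_{L²}, on the Fourier side. -/
def homSobNorm (s : ℝ) (f : EuclideanSpace ℝ (Fin 2) → ℂ) : ℝ≥0∞ :=
  (∫⁻ ξ, ENNReal.ofReal (‖ξ‖ ^ (2 * s) * ‖𝓕 f ξ‖ ^ 2)) ^ (1 / 2 : ℝ)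

/-- Powers of the norm above the critical exponent `-2` are integrable on balls of the plane. -/
lemma setLIntegral_enorm_rpow_closedBall_ne_top {p : ℝ} (hp : -2 < p) :
    ∫⁻ x in Metric.closedBall (0 : EuclideanSpace ℝ (Fin 2)) 1, ‖x‖ₑ ^ p ≠ ⊤ := by
  have hInt : IntegrableOn (fun x : EuclideanSpace ℝ (Fin 2) => ‖x‖ ^ p)
      (Metric.ball 0 2) volume := by
    refine integrableOn_ball_of_norm_le_rpow (C := 1) (α := -p) (by simp) (by simp; linarith)
      (.of_forall fun x => ?_) ?_
    · rw [Real.norm_of_nonneg (by positivity), neg_neg, one_mul]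
    · exact (measurable_norm.pow_const p).aestronglyMeasurable
  have hlt := (hInt.mono_set (Metric.closedBall_subset_ball (one_lt_two))).2
  refine ne_of_lt (lt_of_eq_of_lt (lintegral_congr_ae ?_) hlt)
  filter_upwards [ae_restrict_of_ae (Measure.ae_ne volume (0 : EuclideanSpace ℝ (Fin 2)))] with x hx
  rw [← ofReal_norm, ENNReal.ofReal_rpow_of_pos (norm_pos_iff.2 hx), ← ofReal_norm,
    Real.norm_of_nonneg (by positivity)]

lemma setLIntegral_enorm_rpow_closedBall (p : ℝ) {R : ℝ} (hR : 0 < R) :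
    ∫⁻ x in Metric.closedBall (0 : EuclideanSpace ℝ (Fin 2)) R, ‖x‖ₑ ^ p
      = (∫⁻ x in Metric.closedBall (0 : EuclideanSpace ℝ (Fin 2)) 1, ‖x‖ₑ ^ p)
        * ENNReal.ofReal R ^ (p + 2) := by
  have hR0 : ENNReal.ofReal R ≠ 0 := by simpa using hR
  have hg : Measurable ((Metric.closedBall (0 : EuclideanSpace ℝ (Fin 2)) R).indicator
      (fun x => ‖x‖ₑ ^ p)) := by
    refine Measurable.indicator ?_ measurableSet_closedBall
    fun_prop
  have hmap := congrArg (fun μ => ∫⁻ x, (Metric.closedBall (0 : EuclideanSpace ℝ (Fin 2))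
    R).indicator (fun x => ‖x‖ₑ ^ p) x ∂μ) (Measure.map_addHaar_smul volume hR.ne')
  simp only [lintegral_smul_measure, finrank_euclideanSpace, Fintype.card_fin] at hmap
  rw [lintegral_map hg (measurable_const_smul R), lintegral_indicator measurableSet_closedBall]
    at hmap
  have hcomp : ∀ x : EuclideanSpace ℝ (Fin 2),
      (Metric.closedBall (0 : EuclideanSpace ℝ (Fin 2)) R).indicator (fun x => ‖x‖ₑ ^ p) (R • x)
      = ENNReal.ofReal R ^ p * (Metric.closedBall (0 : EuclideanSpace ℝ (Fin 2)) 1).indicator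
        (fun x => ‖x‖ₑ ^ p) x := by
    intro x
    have hmem : R • x ∈ Metric.closedBall (0 : EuclideanSpace ℝ (Fin 2)) R ↔
        x ∈ Metric.closedBall (0 : EuclideanSpace ℝ (Fin 2)) 1 := by
      simp [norm_smul, abs_of_pos hR, hR]
    by_cases hx : x ∈ Metric.closedBall (0 : EuclideanSpace ℝ (Fin 2)) 1
    · rw [Set.indicator_of_mem hx, Set.indicator_of_mem (hmem.2 hx), enorm_smul,
        Real.enorm_of_nonneg hR.le]
      rcases eq_or_ne ‖x‖ₑ ⊤ with h | h
      · simp at h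
      · exact ENNReal.mul_rpow_of_ne_top ENNReal.ofReal_ne_top h p
    · rw [Set.indicator_of_notMem hx, Set.indicator_of_notMem (fun h => hx (hmem.1 h)), mul_zero]
  simp only [hcomp] at hmap
  rw [lintegral_const_mul' _ _ (by simp [ENNReal.rpow_eq_top_iff, hR.not_ge]),
    lintegral_indicator measurableSet_closedBall, abs_of_pos (by positivity),
    ENNReal.ofReal_inv_of_pos (by positivity), ENNReal.ofReal_pow hR.le, smul_eq_mul] at hmap
  rw [ENNReal.rpow_add _ _ hR0 ENNReal.ofReal_ne_top, ENNReal.rpow_two, ← mul_assoc,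
    mul_comm _ (_ ^ p), hmap, mul_right_comm, ENNReal.inv_mul_cancel (by simpa using hR) (by simp),
    one_mul]

lemma lintegral_sq_le_of_sq_le_mul {α : Type*} [MeasurableSpace α] {μ : Measure α}
    {h p q : α → ℝ≥0∞} (hp : AEMeasurable p μ) (hq : AEMeasurable q μ)
    (hpq : ∀ᵐ a ∂μ, h a ^ 2 ≤ p a * q a) :
    (∫⁻ a, h a ∂μ) ^ 2 ≤ (∫⁻ a, p a ∂μ) * ∫⁻ a, q a ∂μ := by
  have hle : ∫⁻ a, h a ∂μ ≤ (∫⁻ a, p a ∂μ) ^ (1 / 2 : ℝ) * (∫⁻ a, q a ∂μ) ^ (1 / 2 : ℝ) := by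
    refine (lintegral_mono_ae ?_).trans (ENNReal.lintegral_mul_norm_pow_le hp hq
      (by norm_num) (by norm_num) (by norm_num))
    filter_upwards [hpq] with a ha
    rw [← ENNReal.mul_rpow_of_nonneg _ _ (by norm_num), one_div,
      ENNReal.le_rpow_inv_iff (by norm_num), ENNReal.rpow_two]
    exact ha
  calc _ ≤ ((∫⁻ a, p a ∂μ) ^ (1 / 2 : ℝ) * (∫⁻ a, q a ∂μ) ^ (1 / 2 : ℝ)) ^ 2 := by gcongr
    _ = _ := by
      rw [← ENNReal.mul_rpow_of_nonneg _ _ (by norm_num), ← ENNReal.rpow_natCast,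
        ← ENNReal.rpow_mul]
      norm_num

lemma fourier_mul_enorm_le (ψ φ : SchwartzMap (EuclideanSpace ℝ (Fin 2)) ℂ)
    (ξ : EuclideanSpace ℝ (Fin 2)) :
    ‖𝓕 (fun x => ψ x * φ x) ξ‖ₑ ≤
      ∫⁻ η, ‖𝓕 (ψ : EuclideanSpace ℝ (Fin 2) → ℂ) η‖ₑ *
        ‖𝓕 (φ : EuclideanSpace ℝ (Fin 2) → ℂ) (ξ - η)‖ₑ := by
  have hconv := SchwartzMap.convolution_apply (ContinuousLinearMap.mul ℂ ℂ) (𝓕⁻ ψ) (𝓕⁻ φ) (-ξ)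
  have hpair : 𝓕⁻ (fun x => ψ x * φ x) (-ξ) =
      SchwartzMap.convolution (ContinuousLinearMap.mul ℂ ℂ) (𝓕⁻ ψ) (𝓕⁻ φ) (-ξ) := by
    simp [SchwartzMap.convolution, SchwartzMap.fourierInv_coe]
    rfl
  rw [hconv, Real.fourierInv_eq_fourier_neg, neg_neg] at hpair
  rw [hpair]
  refine (enorm_integral_le_lintegral_enorm _).trans_eq ?_
  rw [← lintegral_neg_eq_self]
  refine lintegral_congr fun η => ?_
  simp [SchwartzMap.fourierInv_coe, Real.fourierInv_eq_fourier_neg, neg_add_eq_sub]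

/-- The weight `⟨x⟩^{2s} = (1 + |x|²)^s` with values in `ℝ≥0∞`. -/
def besselWeight (s : ℝ) (x : EuclideanSpace ℝ (Fin 2)) : ℝ≥0∞ := (1 + ‖x‖ₑ ^ 2) ^ s

lemma measurable_besselWeight (s : ℝ) : Measurable (besselWeight s) := by
  unfold besselWeight; fun_prop

lemma besselWeight_ne_top {s : ℝ} (hs : 0 ≤ s) (x : EuclideanSpace ℝ (Fin 2)) :
    besselWeight s x ≠ ⊤ :=
  ENNReal.rpow_ne_top_of_nonneg hs (by finiteness)

lemma besselWeight_ne_zero {s : ℝ} (hs : 0 ≤ s) (x : EuclideanSpace ℝ (Fin 2)) :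
    besselWeight s x ≠ 0 := by
  simp [besselWeight, ENNReal.rpow_eq_zero_iff, hs.not_gt]

lemma enorm_rpow_le_besselWeight {s : ℝ} (hs : 0 ≤ s) (x : EuclideanSpace ℝ (Fin 2)) :
    ‖x‖ₑ ^ (2 * s) ≤ besselWeight s x := by
  rw [ENNReal.rpow_mul, ENNReal.rpow_two]
  exact ENNReal.rpow_le_rpow le_add_self hs

lemma ENNReal.four_rpow_le_two {s : ℝ} (hs : s ≤ 1 / 2) : (4 : ℝ≥0∞) ^ s ≤ 2 := by
  calc (4 : ℝ≥0∞) ^ s ≤ 4 ^ (1 / 2 : ℝ) := ENNReal.rpow_le_rpow_of_exponent_le (by norm_num) hs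
    _ = ((2 : ℝ≥0∞) ^ (2 : ℝ)) ^ (1 / 2 : ℝ) := by norm_num
    _ = 2 := by rw [← ENNReal.rpow_mul]; norm_num

lemma enorm_le_two_mul {x y : EuclideanSpace ℝ (Fin 2)} (h : ‖x‖ ≤ 2 * ‖y‖) :
    ‖x‖ₑ ≤ 2 * ‖y‖ₑ := by
  calc ‖x‖ₑ = ENNReal.ofReal ‖x‖ := (ofReal_norm x).symm
    _ ≤ ENNReal.ofReal (2 * ‖y‖) := ENNReal.ofReal_le_ofReal h
    _ = _ := by rw [ENNReal.ofReal_mul (by norm_num), ofReal_norm, ENNReal.ofReal_ofNat]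

lemma besselWeight_le_two_mul {s : ℝ} (hs0 : 0 ≤ s) (hs : s ≤ 1 / 2)
    {x y : EuclideanSpace ℝ (Fin 2)} (h : ‖x‖ ≤ 2 * ‖y‖) :
    besselWeight s x ≤ 2 * besselWeight s y := by
  have h4 : 1 + ‖x‖ₑ ^ 2 ≤ 4 * (1 + ‖y‖ₑ ^ 2) := by
    calc 1 + ‖x‖ₑ ^ 2 ≤ 4 + (2 * ‖y‖ₑ) ^ 2 := by
          gcongr
          · norm_num
          · exact enorm_le_two_mul h
      _ = _ := by ring
  calc besselWeight s x ≤ (4 * (1 + ‖y‖ₑ ^ 2)) ^ s := ENNReal.rpow_le_rpow h4 hs0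
    _ = 4 ^ s * besselWeight s y := ENNReal.mul_rpow_of_nonneg _ _ hs0
    _ ≤ _ := by gcongr; exact ENNReal.four_rpow_le_two hs

lemma lintegral_sub_left (f : EuclideanSpace ℝ (Fin 2) → ℝ≥0∞) (ξ : EuclideanSpace ℝ (Fin 2)) :
    ∫⁻ η, f (ξ - η) = ∫⁻ η, f η :=
  (Measure.measurePreserving_sub_left volume ξ).lintegral_comp_emb
    (MeasurableEquiv.subLeft ξ).measurableEmbedding f

/-- The contribution of two inputs of frequency larger than the output frequency. -/
lemma lintegral_highFrequencyInputs_le {s : ℝ} (hs0 : 0 < s) (hs : s ≤ 1 / 2)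
    {F G : EuclideanSpace ℝ (Fin 2) → ℝ≥0∞} (hF : Measurable F) (hG : Measurable G) :
    ∫⁻ ξ, ‖ξ‖ₑ ^ (4 * s - 2) *
        (∫⁻ η in {η | ‖ξ‖ ≤ ‖η‖ ∧ ‖ξ‖ ≤ ‖ξ - η‖}, F η * G (ξ - η)) ^ 2
      ≤ 2 * (∫⁻ x in Metric.closedBall (0 : EuclideanSpace ℝ (Fin 2)) 1, ‖x‖ₑ ^ (4 * s - 2)) *
        ((∫⁻ η, besselWeight s η * F η ^ 2) * ∫⁻ η, besselWeight s η * G η ^ 2) := by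
  set K := ∫⁻ x in Metric.closedBall (0 : EuclideanSpace ℝ (Fin 2)) 1, ‖x‖ₑ ^ (4 * s - 2)
  set A := ∫⁻ η, besselWeight s η * F η ^ 2
  have hw := measurable_besselWeight s
  let q : EuclideanSpace ℝ (Fin 2) → ℝ≥0∞ := fun ζ => 2 * (besselWeight s ζ)⁻¹ * G ζ ^ 2
  have hq : Measurable q := by fun_prop
  have hCS : ∀ ξ : EuclideanSpace ℝ (Fin 2),
      (∫⁻ η in {η | ‖ξ‖ ≤ ‖η‖ ∧ ‖ξ‖ ≤ ‖ξ - η‖}, F η * G (ξ - η)) ^ 2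
        ≤ A * ∫⁻ ζ, {ζ : EuclideanSpace ℝ (Fin 2) | ‖ξ‖ ≤ ‖ζ‖}.indicator q ζ := by
    intro ξ
    have hS : MeasurableSet {η : EuclideanSpace ℝ (Fin 2) | ‖ξ‖ ≤ ‖η‖ ∧ ‖ξ‖ ≤ ‖ξ - η‖} := by
      measurability
    refine (lintegral_sq_le_of_sq_le_mul (p := fun η => besselWeight s η * F η ^ 2)
      (q := fun η => {ζ : EuclideanSpace ℝ (Fin 2) | ‖ξ‖ ≤ ‖ζ‖}.indicator q (ξ - η)) (by fun_prop) ?_ ?_).trans ?_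
    · exact ((hq.indicator (measurableSet_le measurable_const measurable_norm)).comp
        (measurable_const.sub measurable_id)).aemeasurable
    · filter_upwards [ae_restrict_mem hS] with η hη
      rw [Set.indicator_of_mem (by exact hη.2)]
      have hle : ‖ξ - η‖ ≤ 2 * ‖η‖ := by
        have := norm_sub_le ξ η
        linarith [hη.1]
      have h1 : 1 ≤ 2 * besselWeight s η * (besselWeight s (ξ - η))⁻¹ := by
        rw [← div_eq_mul_inv, ENNReal.le_div_iff_mul_le (.inl (besselWeight_ne_zero hs0.le _))
          (.inl (besselWeight_ne_top hs0.le _)), one_mul]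
        exact besselWeight_le_two_mul hs0.le hs hle
      calc (F η * G (ξ - η)) ^ 2 = 1 * (F η ^ 2 * G (ξ - η) ^ 2) := by ring
        _ ≤ (2 * besselWeight s η * (besselWeight s (ξ - η))⁻¹) *
            (F η ^ 2 * G (ξ - η) ^ 2) := by gcongr
        _ = _ := by simp only [q]; ring
    · refine mul_le_mul' (setLIntegral_le_lintegral _ _)
        ((setLIntegral_le_lintegral _ _).trans_eq ?_)
      exact lintegral_sub_left _ ξ
  have hball : ∀ ζ : EuclideanSpace ℝ (Fin 2),
      ∫⁻ ξ : EuclideanSpace ℝ (Fin 2), ‖ξ‖ₑ ^ (4 * s - 2) *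
          {ζ : EuclideanSpace ℝ (Fin 2) | ‖ξ‖ ≤ ‖ζ‖}.indicator q ζ
        ≤ 2 * K * (besselWeight s ζ * G ζ ^ 2) := by
    intro ζ
    have hw0 := besselWeight_ne_zero hs0.le ζ
    have hwt := besselWeight_ne_top hs0.le ζ
    have hInt : ∫⁻ ξ in Metric.closedBall (0 : EuclideanSpace ℝ (Fin 2)) ‖ζ‖, ‖ξ‖ₑ ^ (4 * s - 2)
        ≤ K * besselWeight s ζ ^ 2 := by
      rcases eq_or_ne ζ 0 with rfl | hζ
      · simp
      rw [setLIntegral_enorm_rpow_closedBall _ (norm_pos_iff.2 hζ), ofReal_norm]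
      gcongr
      calc ‖ζ‖ₑ ^ (4 * s - 2 + 2) = (‖ζ‖ₑ ^ (2 * s)) ^ (2 : ℝ) := by
            rw [← ENNReal.rpow_mul]; ring_nf
        _ ≤ _ := by
            rw [ENNReal.rpow_two]
            gcongr
            exact enorm_rpow_le_besselWeight hs0.le ζ
    calc _ = ∫⁻ ξ in Metric.closedBall (0 : EuclideanSpace ℝ (Fin 2)) ‖ζ‖,
          ‖ξ‖ₑ ^ (4 * s - 2) * q ζ := by
          rw [← lintegral_indicator measurableSet_closedBall]
          refine lintegral_congr fun ξ => ?_
          by_cases h : ‖ξ‖ ≤ ‖ζ‖ <;> simp [Set.indicator, h]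
      _ ≤ K * besselWeight s ζ ^ 2 * q ζ := by
          rw [lintegral_mul_const _ (by fun_prop)]
          gcongr
      _ = 2 * K * (besselWeight s ζ * G ζ ^ 2) *
          (besselWeight s ζ * (besselWeight s ζ)⁻¹) := by simp only [q]; ring
      _ = _ := by rw [ENNReal.mul_inv_cancel hw0 hwt, mul_one]
  calc _ ≤ ∫⁻ ξ, A * ∫⁻ ζ, ‖ξ‖ₑ ^ (4 * s - 2) *
          {ζ : EuclideanSpace ℝ (Fin 2) | ‖ξ‖ ≤ ‖ζ‖}.indicator q ζ := by
        refine lintegral_mono fun ξ => ?_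
        rw [lintegral_const_mul _ (hq.indicator (measurableSet_le measurable_const measurable_norm)),
          mul_left_comm]
        gcongr
        exact hCS ξ
    _ = A * ∫⁻ ζ, ∫⁻ ξ, ‖ξ‖ₑ ^ (4 * s - 2) *
          {ζ : EuclideanSpace ℝ (Fin 2) | ‖ξ‖ ≤ ‖ζ‖}.indicator q ζ := by
        have hmeas : Measurable (fun z : EuclideanSpace ℝ (Fin 2) × EuclideanSpace ℝ (Fin 2) =>
            ‖z.1‖ₑ ^ (4 * s - 2) * {ζ | ‖z.1‖ ≤ ‖ζ‖}.indicator q z.2) := by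
          refine Measurable.mul (by fun_prop) ?_
          exact (hq.comp measurable_snd).indicator
            (measurableSet_le measurable_fst.norm measurable_snd.norm)
        rw [lintegral_const_mul _ hmeas.lintegral_prod_right', lintegral_lintegral_swap]
        exact hmeas.aemeasurable
    _ ≤ A * ∫⁻ ζ, 2 * K * (besselWeight s ζ * G ζ ^ 2) := by
        gcongr with ζ
        exact hball ζ
    _ = _ := by
        rw [lintegral_const_mul _ (by fun_prop)]
        ring

/-- The contribution of an input of frequency smaller than both other frequencies. -/
lemma lintegral_lowFrequencyInput_le {s : ℝ} (hs0 : 0 < s) (hs : s ≤ 1 / 2)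
    {F G : EuclideanSpace ℝ (Fin 2) → ℝ≥0∞} (hF : Measurable F) (hG : Measurable G) :
    ∫⁻ ξ, ‖ξ‖ₑ ^ (4 * s - 2) *
        (∫⁻ η in {η | ‖η‖ ≤ ‖ξ‖ ∧ ‖η‖ ≤ ‖ξ - η‖}, F η * G (ξ - η)) ^ 2
      ≤ 2 * (∫⁻ x in Metric.closedBall (0 : EuclideanSpace ℝ (Fin 2)) 1, ‖x‖ₑ ^ (-(2 * s))) *
        ((∫⁻ η, besselWeight s η * F η ^ 2) * ∫⁻ η, besselWeight s η * G η ^ 2) := by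
  set K := ∫⁻ x in Metric.closedBall (0 : EuclideanSpace ℝ (Fin 2)) 1, ‖x‖ₑ ^ (-(2 * s))
  have hw := measurable_besselWeight s
  have hpt : ∀ ξ : EuclideanSpace ℝ (Fin 2), ξ ≠ 0 → ‖ξ‖ₑ ^ (4 * s - 2) *
        (∫⁻ η in {η | ‖η‖ ≤ ‖ξ‖ ∧ ‖η‖ ≤ ‖ξ - η‖}, F η * G (ξ - η)) ^ 2 ≤
      2 * K * ∫⁻ η, besselWeight s η * F η ^ 2 * (besselWeight s (ξ - η) * G (ξ - η) ^ 2) := by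
    intro ξ hξ
    have hξ0 : ‖ξ‖ₑ ≠ 0 := by simpa using hξ
    have hS : MeasurableSet {η : EuclideanSpace ℝ (Fin 2) | ‖η‖ ≤ ‖ξ‖ ∧ ‖η‖ ≤ ‖ξ - η‖} := by
      measurability
    have hCS := lintegral_sq_le_of_sq_le_mul
      (μ := volume.restrict {η : EuclideanSpace ℝ (Fin 2) | ‖η‖ ≤ ‖ξ‖ ∧ ‖η‖ ≤ ‖ξ - η‖})
      (h := fun η => F η * G (ξ - η))
      (p := fun η => besselWeight s η * F η ^ 2 * (besselWeight s (ξ - η) * G (ξ - η) ^ 2))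
      (q := fun η => 2 * ‖ξ‖ₑ ^ (-(2 * s)) * ‖η‖ₑ ^ (-(2 * s))) (by fun_prop) (by fun_prop) (by
        filter_upwards [ae_restrict_mem hS] with η hη
        have hle : ‖ξ‖ ≤ 2 * ‖ξ - η‖ := by
          have := norm_add_le (ξ - η) η
          rw [sub_add_cancel] at this
          linarith [hη.2]
        have h1 : 1 ≤ besselWeight s η * ‖η‖ₑ ^ (-(2 * s)) := by
          rw [ENNReal.rpow_neg, ← div_eq_mul_inv,
            ENNReal.le_div_iff_mul_le (.inr (besselWeight_ne_zero hs0.le _))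
              (.inr (besselWeight_ne_top hs0.le _)), one_mul]
          exact enorm_rpow_le_besselWeight hs0.le η
        have h2 : 1 ≤ besselWeight s (ξ - η) * (2 * ‖ξ‖ₑ ^ (-(2 * s))) := by
          rw [← mul_assoc, ENNReal.rpow_neg, ← div_eq_mul_inv, mul_comm _ 2,
            ENNReal.le_div_iff_mul_le (.inl (by simp [hξ0]))
              (.inl (ENNReal.rpow_ne_top_of_nonneg (by linarith) enorm_ne_top)), one_mul]
          exact (enorm_rpow_le_besselWeight hs0.le ξ).trans
            (besselWeight_le_two_mul hs0.le hs hle)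
        calc (F η * G (ξ - η)) ^ 2 = 1 * 1 * (F η ^ 2 * G (ξ - η) ^ 2) := by ring
          _ ≤ (besselWeight s η * ‖η‖ₑ ^ (-(2 * s))) *
              (besselWeight s (ξ - η) * (2 * ‖ξ‖ₑ ^ (-(2 * s)))) *
              (F η ^ 2 * G (ξ - η) ^ 2) := by gcongr
          _ = _ := by ring)
    have hball : ‖ξ‖ₑ ^ (4 * s - 2) * ∫⁻ η in {η | ‖η‖ ≤ ‖ξ‖ ∧ ‖η‖ ≤ ‖ξ - η‖},
        2 * ‖ξ‖ₑ ^ (-(2 * s)) * ‖η‖ₑ ^ (-(2 * s)) ≤ 2 * K := by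
      rw [lintegral_const_mul _ (by fun_prop)]
      calc _ ≤ ‖ξ‖ₑ ^ (4 * s - 2) * (2 * ‖ξ‖ₑ ^ (-(2 * s)) *
            ∫⁻ η in Metric.closedBall (0 : EuclideanSpace ℝ (Fin 2)) ‖ξ‖,
              ‖η‖ₑ ^ (-(2 * s))) := by
            gcongr
            intro η hη
            simpa using hη.1
        _ = 2 * K * (‖ξ‖ₑ ^ (4 * s - 2) * ‖ξ‖ₑ ^ (-(2 * s)) * ‖ξ‖ₑ ^ (-(2 * s) + 2)) := by
            rw [setLIntegral_enorm_rpow_closedBall _ (norm_pos_iff.2 hξ), ofReal_norm]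
            ring
        _ = 2 * K := by
            rw [← ENNReal.rpow_add _ _ hξ0 enorm_ne_top, ← ENNReal.rpow_add _ _ hξ0 enorm_ne_top]
            ring_nf
            simp
    calc _ ≤ ‖ξ‖ₑ ^ (4 * s - 2) * ((∫⁻ η in {η | ‖η‖ ≤ ‖ξ‖ ∧ ‖η‖ ≤ ‖ξ - η‖},
          besselWeight s η * F η ^ 2 * (besselWeight s (ξ - η) * G (ξ - η) ^ 2)) *
          ∫⁻ η in {η | ‖η‖ ≤ ‖ξ‖ ∧ ‖η‖ ≤ ‖ξ - η‖},
            2 * ‖ξ‖ₑ ^ (-(2 * s)) * ‖η‖ₑ ^ (-(2 * s))) := by gcongr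
      _ = (‖ξ‖ₑ ^ (4 * s - 2) * ∫⁻ η in {η | ‖η‖ ≤ ‖ξ‖ ∧ ‖η‖ ≤ ‖ξ - η‖},
            2 * ‖ξ‖ₑ ^ (-(2 * s)) * ‖η‖ₑ ^ (-(2 * s))) *
          (∫⁻ η in {η | ‖η‖ ≤ ‖ξ‖ ∧ ‖η‖ ≤ ‖ξ - η‖},
          besselWeight s η * F η ^ 2 * (besselWeight s (ξ - η) * G (ξ - η) ^ 2)) := by ring
      _ ≤ _ := mul_le_mul' hball (setLIntegral_le_lintegral _ _)
  have hmeas : Measurable (fun z : EuclideanSpace ℝ (Fin 2) × EuclideanSpace ℝ (Fin 2) =>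
      besselWeight s z.2 * F z.2 ^ 2 * (besselWeight s (z.1 - z.2) * G (z.1 - z.2) ^ 2)) := by
    fun_prop
  calc _ ≤ ∫⁻ ξ, 2 * K * ∫⁻ η, besselWeight s η * F η ^ 2 *
          (besselWeight s (ξ - η) * G (ξ - η) ^ 2) := by
        refine lintegral_mono_ae ?_
        filter_upwards [Measure.ae_ne volume (0 : EuclideanSpace ℝ (Fin 2))] with ξ hξ
        exact hpt ξ hξ
    _ = 2 * K * ∫⁻ η, ∫⁻ ξ, besselWeight s η * F η ^ 2 *
          (besselWeight s (ξ - η) * G (ξ - η) ^ 2) := by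
        rw [lintegral_const_mul _ hmeas.lintegral_prod_right', lintegral_lintegral_swap]
        exact hmeas.aemeasurable
    _ = 2 * K * ∫⁻ η, besselWeight s η * F η ^ 2 * ∫⁻ ξ, besselWeight s ξ * G ξ ^ 2 := by
        congr 1
        refine lintegral_congr fun η => ?_
        rw [lintegral_const_mul _ (by fun_prop),
          lintegral_sub_right_eq_self (fun ξ => besselWeight s ξ * G ξ ^ 2) η]
    _ = _ := by rw [lintegral_mul_const _ (by fun_prop)]

lemma ENNReal.add_add_sq_le (a b c : ℝ≥0∞) : (a + b + c) ^ 2 ≤ 3 * (a ^ 2 + b ^ 2 + c ^ 2) := by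
  induction a with
  | top => simp
  | coe a =>
  induction b with
  | top => simp
  | coe b =>
  induction c with
  | top => simp
  | coe c =>
  norm_cast
  rw [← NNReal.coe_le_coe]
  push_cast
  nlinarith [sq_nonneg ((a : ℝ) - b), sq_nonneg ((a : ℝ) - c), sq_nonneg ((b : ℝ) - c)]

/-- The bilinear estimate in frequency space. -/
lemma lintegral_convolution_sq_le {s : ℝ} (hs0 : 0 < s) (hs : s ≤ 1 / 2) :
    ∃ C : ℝ≥0∞, C ≠ ⊤ ∧ ∀ F G : EuclideanSpace ℝ (Fin 2) → ℝ≥0∞, Measurable F → Measurable G →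
      ∫⁻ ξ, ‖ξ‖ₑ ^ (4 * s - 2) * (∫⁻ η, F η * G (ξ - η)) ^ 2
        ≤ C * ((∫⁻ η, besselWeight s η * F η ^ 2) * ∫⁻ η, besselWeight s η * G η ^ 2) := by
  set K₁ := ∫⁻ x in Metric.closedBall (0 : EuclideanSpace ℝ (Fin 2)) 1, ‖x‖ₑ ^ (4 * s - 2)
  set K₂ := ∫⁻ x in Metric.closedBall (0 : EuclideanSpace ℝ (Fin 2)) 1, ‖x‖ₑ ^ (-(2 * s))
  have h₁ : K₁ ≠ ⊤ := setLIntegral_enorm_rpow_closedBall_ne_top (by linarith)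
  have h₂ : K₂ ≠ ⊤ := setLIntegral_enorm_rpow_closedBall_ne_top (by linarith)
  refine ⟨3 * (2 * K₁ + 2 * K₂ + 2 * K₂), by finiteness, fun F G hF hG => ?_⟩
  set A := ∫⁻ η, besselWeight s η * F η ^ 2
  set B := ∫⁻ η, besselWeight s η * G η ^ 2
  let T₁ : EuclideanSpace ℝ (Fin 2) → ℝ≥0∞ := fun ξ =>
    ∫⁻ η in {η | ‖ξ‖ ≤ ‖η‖ ∧ ‖ξ‖ ≤ ‖ξ - η‖}, F η * G (ξ - η)
  let T₂ : (EuclideanSpace ℝ (Fin 2) → ℝ≥0∞) → (EuclideanSpace ℝ (Fin 2) → ℝ≥0∞) →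
      EuclideanSpace ℝ (Fin 2) → ℝ≥0∞ := fun F G ξ =>
    ∫⁻ η in {η | ‖η‖ ≤ ‖ξ‖ ∧ ‖η‖ ≤ ‖ξ - η‖}, F η * G (ξ - η)
  have hb₁ : ∫⁻ ξ, ‖ξ‖ₑ ^ (4 * s - 2) * T₁ ξ ^ 2 ≤ 2 * K₁ * (A * B) :=
    lintegral_highFrequencyInputs_le hs0 hs hF hG
  have hb₂ : ∫⁻ ξ, ‖ξ‖ₑ ^ (4 * s - 2) * T₂ F G ξ ^ 2 ≤ 2 * K₂ * (A * B) :=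
    lintegral_lowFrequencyInput_le hs0 hs hF hG
  have hb₃ : ∫⁻ ξ, ‖ξ‖ₑ ^ (4 * s - 2) * T₂ G F ξ ^ 2 ≤ 2 * K₂ * (B * A) :=
    lintegral_lowFrequencyInput_le hs0 hs hG hF
  have hmeas : ∀ {S : Set (EuclideanSpace ℝ (Fin 2) × EuclideanSpace ℝ (Fin 2))},
      MeasurableSet S → ∀ {F G : EuclideanSpace ℝ (Fin 2) → ℝ≥0∞}, Measurable F → Measurable G →
      Measurable fun ξ => ∫⁻ η in {η | (ξ, η) ∈ S}, F η * G (ξ - η) := by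
    intro S hS F G hF hG
    have : ∀ ξ, ∫⁻ η in {η | (ξ, η) ∈ S}, F η * G (ξ - η) =
        ∫⁻ η, S.indicator (fun z => F z.2 * G (z.1 - z.2)) (ξ, η) := fun ξ => by
      rw [← lintegral_indicator (s := {η | (ξ, η) ∈ S}) (measurable_prodMk_left hS)]
      rfl
    simp_rw [this]
    refine Measurable.lintegral_prod_right' (Measurable.indicator ?_ hS)
    fun_prop
  have hm₁ : Measurable T₁ := by
    refine hmeas (S := {z | ‖z.1‖ ≤ ‖z.2‖ ∧ ‖z.1‖ ≤ ‖z.1 - z.2‖}) ?_ hF hG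
    measurability
  have hm₂ : Measurable (T₂ F G) := by
    refine hmeas (S := {z | ‖z.2‖ ≤ ‖z.1‖ ∧ ‖z.2‖ ≤ ‖z.1 - z.2‖}) ?_ hF hG
    measurability
  have hsplit : ∀ ξ, ∫⁻ η, F η * G (ξ - η) ≤ T₁ ξ + T₂ F G ξ + T₂ G F ξ := by
    intro ξ
    have hT₃ : T₂ G F ξ = ∫⁻ η in {η | ‖ξ - η‖ ≤ ‖ξ‖ ∧ ‖ξ - η‖ ≤ ‖η‖}, F η * G (ξ - η) := by
      simp only [T₂]
      rw [← lintegral_indicator (by measurability), ← lintegral_indicator (by measurability),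
        ← lintegral_sub_left _ ξ]
      refine lintegral_congr fun η => ?_
      simp [Set.indicator, mul_comm]
    rw [hT₃]
    refine le_trans ?_ ((lintegral_union_le _ _ _).trans
      (add_le_add_left (lintegral_union_le _ _ _) _))
    rw [← setLIntegral_univ]
    refine lintegral_mono_set fun η _ => ?_
    simp only [Set.mem_union, Set.mem_ofPred_eq]
    grind
  calc _ ≤ ∫⁻ ξ, 3 * (‖ξ‖ₑ ^ (4 * s - 2) * T₁ ξ ^ 2 + ‖ξ‖ₑ ^ (4 * s - 2) * T₂ F G ξ ^ 2 +
          ‖ξ‖ₑ ^ (4 * s - 2) * T₂ G F ξ ^ 2) := by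
        refine lintegral_mono fun ξ => ?_
        calc _ ≤ ‖ξ‖ₑ ^ (4 * s - 2) * (T₁ ξ + T₂ F G ξ + T₂ G F ξ) ^ 2 := by
              gcongr
              exact hsplit ξ
          _ ≤ ‖ξ‖ₑ ^ (4 * s - 2) * (3 * (T₁ ξ ^ 2 + T₂ F G ξ ^ 2 + T₂ G F ξ ^ 2)) := by
              gcongr
              exact ENNReal.add_add_sq_le _ _ _
          _ = _ := by ring
    _ = 3 * ((∫⁻ ξ, ‖ξ‖ₑ ^ (4 * s - 2) * T₁ ξ ^ 2) + (∫⁻ ξ, ‖ξ‖ₑ ^ (4 * s - 2) * T₂ F G ξ ^ 2) +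
          ∫⁻ ξ, ‖ξ‖ₑ ^ (4 * s - 2) * T₂ G F ξ ^ 2) := by
        rw [lintegral_const_mul' _ _ (by norm_num), lintegral_add_left (by fun_prop),
          lintegral_add_left (by fun_prop)]
    _ ≤ 3 * (2 * K₁ * (A * B) + 2 * K₂ * (A * B) + 2 * K₂ * (B * A)) := by gcongr
    _ = _ := by ring

lemma ENNReal.ofReal_rpow_le (p : ℝ) {x : ℝ} (hx : 0 ≤ x) :
    ENNReal.ofReal (x ^ p) ≤ ENNReal.ofReal x ^ p := by
  rcases hx.eq_or_lt with rfl | hx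
  · rcases eq_or_ne p 0 with rfl | hp
    · simp
    · simp [Real.zero_rpow hp]
  · exact (ENNReal.ofReal_rpow_of_pos hx).ge

lemma sobNorm_eq (s : ℝ) (f : EuclideanSpace ℝ (Fin 2) → ℂ) :
    sobNorm s f = (∫⁻ ξ, besselWeight s ξ * ‖𝓕 f ξ‖ₑ ^ 2) ^ (1 / 2 : ℝ) := by
  unfold sobNorm besselWeight
  congr 2 with ξ
  rw [ENNReal.ofReal_mul (by positivity), ← ENNReal.ofReal_rpow_of_pos (by positivity),
    ENNReal.ofReal_add (by norm_num) (by positivity), ENNReal.ofReal_pow (norm_nonneg _),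
    ENNReal.ofReal_pow (norm_nonneg _), ofReal_norm, ofReal_norm, ENNReal.ofReal_one]

/-- ‖ψφ‖_{Ḣ^{2s−1}} ≲ ‖ψ‖_{H^s}‖φ‖_{H^s} for 0 < s ≤ 1/2; in particular
A = |∇|⁻¹(ψφ) (whose Fourier transform is |ξ|⁻¹·𝓕(ψφ)) satisfies
‖A‖_{Ḣ^{2s}} ≲ ‖ψ‖_{H^s}‖φ‖_{H^s}. -/
theorem stmt_10 (s : ℝ) (hs0 : 0 < s) (hs : s ≤ 1 / 2) :
    ∃ C : ℝ≥0, ∀ ψ φ : SchwartzMap (EuclideanSpace ℝ (Fin 2)) ℂ,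
      homSobNorm (2 * s - 1) (fun x => ψ x * φ x)
        ≤ (C : ℝ≥0∞) * sobNorm s ψ * sobNorm s φ ∧
      (∫⁻ ξ, ENNReal.ofReal (‖ξ‖ ^ (2 * (2 * s)) *
          ‖((‖ξ‖ : ℂ))⁻¹ * 𝓕 (fun x => ψ x * φ x) ξ‖ ^ 2)) ^ (1 / 2 : ℝ)
        ≤ (C : ℝ≥0∞) * sobNorm s ψ * sobNorm s φ := by
  obtain ⟨C, hC, hbound⟩ := lintegral_convolution_sq_le hs0 hs
  refine ⟨(C ^ (1 / 2 : ℝ)).toNNReal, fun ψ φ => ?_⟩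
  rw [ENNReal.coe_toNNReal (ENNReal.rpow_ne_top_of_nonneg (by norm_num) hC)]
  have hmain : homSobNorm (2 * s - 1) (fun x => ψ x * φ x)
      ≤ C ^ (1 / 2 : ℝ) * sobNorm s ψ * sobNorm s φ := by
    have hmeas : ∀ f : SchwartzMap (EuclideanSpace ℝ (Fin 2)) ℂ,
        Measurable fun ξ => ‖𝓕 (f : EuclideanSpace ℝ (Fin 2) → ℂ) ξ‖ₑ := fun f => by
      rw [← SchwartzMap.fourier_coe]
      exact (𝓕 f).continuous.enorm.measurable
    rw [sobNorm_eq, sobNorm_eq, mul_assoc, ← ENNReal.mul_rpow_of_nonneg _ _ (by norm_num),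
      ← ENNReal.mul_rpow_of_nonneg _ _ (by norm_num)]
    refine ENNReal.rpow_le_rpow (le_trans (lintegral_mono fun ξ => ?_)
      (hbound _ _ (hmeas ψ) (hmeas φ))) (by norm_num)
    rw [ENNReal.ofReal_mul (by positivity), ENNReal.ofReal_pow (norm_nonneg _), ofReal_norm,
      show 2 * (2 * s - 1) = 4 * s - 2 by ring]
    gcongr
    · exact (ENNReal.ofReal_rpow_le _ (norm_nonneg ξ)).trans_eq (by rw [ofReal_norm])
    · exact fourier_mul_enorm_le ψ φ ξ
  refine ⟨hmain, le_trans ?_ hmain⟩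
  refine ENNReal.rpow_le_rpow (lintegral_mono fun ξ => ENNReal.ofReal_le_ofReal ?_) (by norm_num)
  rcases eq_or_ne ξ 0 with rfl | hξ
  · simp only [norm_zero, Complex.ofReal_zero, inv_zero, zero_mul, ne_eq, OfNat.ofNat_ne_zero,
      not_false_eq_true, zero_pow, mul_zero]
    positivity
  · have hpos : 0 < ‖ξ‖ := norm_pos_iff.2 hξ
    rw [norm_mul, norm_inv, Complex.norm_real, norm_norm, mul_pow, ← mul_assoc,
      show 2 * (2 * s - 1) = 2 * (2 * s) - (2 : ℕ) by push_cast; ring, Real.rpow_sub_natCast hpos.ne',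
      inv_pow, div_eq_mul_inv]

end
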